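/- Let e be a uniform resource expression (e ¨ e) and t̄ a resource monomial. For every resource expression e' in the support of the symmetric multilinear substitution ∂_x e · t̄, the coefficient of e' in ∂_x e · t̄ equals m(e)·m(t̄)/m(e'). -/

import Mathlib

set_option maxHeartbeats 1000000

/-! ### Rigid resource terms -/

/-- Rigid resource terms (de Bruijn indices for variables):
`a ::= x | λ.a | ⟨a⟩b⃗ | a⊕• | •⊕a` where argument lists are ordered. -/
inductive Rt : Type
  | var : ℕ → Rt
  | lam : Rt → Rt
  | app : Rt → List Rt → Rt
  | inl : Rt → Rt
  | inr : Rt → Rt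
deriving Inhabited

/-- Rigid resource expressions: terms or (rigid) monomials. -/
abbrev REx : Type := Rt ⊕ List Rt

/-! ### Isomorphism of rigid expressions -/

mutual
  /-- Two rigid terms are isomorphic (`≅`) when they differ only by
  permutations of argument lists. -/
  inductive IsoT : Rt → Rt → Prop
    | var (x : ℕ) : IsoT (.var x) (.var x)
    | lam {a a'} : IsoT a a' → IsoT (.lam a) (.lam a')
    | inl {a a'} : IsoT a a' → IsoT (.inl a) (.inl a')
    | inr {a a'} : IsoT a a' → IsoT (.inr a) (.inr a')
    | app {c c' : Rt} {ds ds' : List Rt} :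
        IsoT c c' → IsoM ds ds' → IsoT (.app c ds) (.app c' ds')
  /-- Isomorphism of rigid monomials: a permutation `σ` together with
  isomorphisms `aᵢ ≅ a'_{σ(i)}`. -/
  inductive IsoM : List Rt → List Rt → Prop
    | mk (as as' : List Rt) (h : as'.length = as.length) (σ : Equiv.Perm (Fin as.length))
        (H : ∀ i : Fin as.length, IsoT (as.get i) (as'.get ((σ i).cast h.symm))) :
        IsoM as as'
end

/-! ### Resource expressions as quotients of rigid expressions -/

/-- Resource terms: rigid terms up to permutations of arguments, i.e. terms
whose argument lists are multisets. -/
def ResTerm : Type := Quot IsoT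

instance : Inhabited ResTerm := ⟨Quot.mk _ (.var 0)⟩

/-- The resource term represented by a rigid term (`r ◁ |r|`). -/
def rmk : Rt → ResTerm := Quot.mk IsoT

/-- A choice of rigid representation of a resource term. -/
noncomputable def rout : ResTerm → Rt := Quot.out

/-- The resource monomial (multiset) represented by a rigid monomial (list). -/
def toMul (bs : List Rt) : Multiset ResTerm := ↑(bs.map rmk)

/-- Resource expressions: terms or monomials (finite multisets of terms). -/
abbrev ResExpr : Type := ResTerm ⊕ Multiset ResTerm

/-- The resource expression represented by a rigid expression. -/
def toQ : REx → ResExpr := Sum.map rmk toMul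

/-- A choice of rigid representation of a resource expression. -/
noncomputable def outE : ResExpr → REx :=
  Sum.map rout (fun m => m.toList.map rout)

/-- Variable as a resource term. -/
def qVar (x : ℕ) : ResTerm := rmk (.var x)

/-- Abstraction on resource terms. -/
noncomputable def qLam (s : ResTerm) : ResTerm := rmk (.lam (rout s))

/-- Left injection `(-) ⊕ •` on resource terms. -/
noncomputable def qInl (s : ResTerm) : ResTerm := rmk (.inl (rout s))

/-- Right injection `• ⊕ (-)` on resource terms. -/
noncomputable def qInr (s : ResTerm) : ResTerm := rmk (.inr (rout s))

/-- Application `⟨s⟩t̄` of a resource term to a resource monomial. -/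
noncomputable def qApp (s : ResTerm) (t : Multiset ResTerm) : ResTerm :=
  rmk (.app (rout s) (t.toList.map rout))

/-! ### Coherence -/

mutual
  /-- Coherence on rigid resource terms. -/
  inductive CohT : Rt → Rt → Prop
    | var (x : ℕ) : CohT (.var x) (.var x)
    | lam {a a'} : CohT a a' → CohT (.lam a) (.lam a')
    | app {c c' : Rt} {ds ds' : List Rt} :
        CohT c c' → CohM ds ds' → CohT (.app c ds) (.app c' ds')
    | inl {a a'} : CohT a a' → CohT (.inl a) (.inl a')
    | inr {a a'} : CohT a a' → CohT (.inr a) (.inr a')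
    | mix (a a' : Rt) : CohT (.inl a) (.inr a')
  /-- Coherence on rigid monomials: all elements pairwise coherent. -/
  inductive CohM : List Rt → List Rt → Prop
    | mk {ds ds' : List Rt} (H : ∀ b ∈ ds ++ ds', ∀ b' ∈ ds ++ ds', CohT b b') :
        CohM ds ds'
end

/-- Coherence on rigid expressions. -/
def CohE : REx → REx → Prop
  | .inl a, .inl a' => CohT a a'
  | .inr l, .inr l' => CohM l l'
  | _, _ => False

/-! ### Coherence on resource expressions -/

/-- Coherence on resource terms. -/
def CohQT (s s' : ResTerm) : Prop :=
  ∃ a a', rmk a = s ∧ rmk a' = s' ∧ CohT a a'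

/-- Coherence on resource monomials. -/
def CohQM (m m' : Multiset ResTerm) : Prop :=
  ∃ bs bs', toMul bs = m ∧ toMul bs' = m' ∧ CohM bs bs'

/-- Coherence on resource expressions. -/
def CohQE : ResExpr → ResExpr → Prop
  | .inl s, .inl s' => CohQT s s'
  | .inr m, .inr m' => CohQM m m'
  | _, _ => False

/-! ### Occurrence counting and rigid substitution -/

namespace Rt

/-- Shift free de Bruijn indices `≥ c` up by one in a rigid term. -/
def shiftR (c : ℕ) : Rt → Rt
  | .var n => .var (if n < c then n else n + 1)
  | .lam a => .lam (a.shiftR (c + 1))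
  | .inl a => .inl (a.shiftR c)
  | .inr a => .inr (a.shiftR c)
  | .app d es => .app (d.shiftR c) (es.attach.map fun e => e.1.shiftR c)
termination_by r => sizeOf r
decreasing_by
  all_goals simp_wf
  all_goals try omega
  all_goals (have := List.sizeOf_lt_of_mem e.2; omega)

end Rt

/-- Number of free occurrences `n_x(a)` of the variable `x` in a rigid term. -/
def nx (x : ℕ) : Rt → ℕ
  | .var n => if n = x then 1 else 0
  | .lam a => nx (x + 1) a
  | .inl a => nx x a
  | .inr a => nx x a
  | .app d es => nx x d + (es.attach.map fun e => nx x e.1).sum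
termination_by r => sizeOf r
decreasing_by
  all_goals simp_wf
  all_goals try omega
  all_goals (have := List.sizeOf_lt_of_mem e.2; omega)

/-- Number of free occurrences of `x` in a rigid monomial. -/
def nxL (x : ℕ) (l : List Rt) : ℕ := (l.map (nx x)).sum

/-- Number of free occurrences of `x` in a rigid expression. -/
def nxE (x : ℕ) : REx → ℕ := Sum.elim (nx x) (nxL x)

mutual
  /-- Rigid substitution `r[b⃗/x]`: the occurrences of `x` in `r`, taken from
  left to right, are replaced by the successive elements of `b⃗`; it is
  undefined (`none`, i.e. the partial rigid expression `0`) unless `n_x(r) = |b⃗|`. -/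
  def rsubst : Rt → ℕ → List Rt → Option Rt
    | .var n, x, bs =>
        if n = x then (match bs with | [b] => some b | _ => none)
        else (match bs with
              | [] => some (.var (if x < n then n - 1 else n))
              | _ => none)
    | .lam a, x, bs => (rsubst a (x + 1) (bs.map (Rt.shiftR 0))).map .lam
    | .inl a, x, bs => (rsubst a x bs).map .inl
    | .inr a, x, bs => (rsubst a x bs).map .inr
    | .app c ds, x, bs =>
        match rsubst c x (bs.take (nx x c)), rsubstL ds x (bs.drop (nx x c)) with
        | some c', some ds' => some (.app c' ds')
        | _, _ => none
  /-- Rigid substitution in a rigid monomial. -/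
  def rsubstL : List Rt → ℕ → List Rt → Option (List Rt)
    | [], _, bs => (match bs with | [] => some [] | _ => none)
    | a :: as, x, bs =>
        match rsubst a x (bs.take (nx x a)), rsubstL as x (bs.drop (nx x a)) with
        | some a', some as' => some (a' :: as')
        | _, _ => none
end

/-- Rigid substitution on rigid expressions. -/
def rsubstE : REx → ℕ → List Rt → Option REx
  | .inl r, x, bs => (rsubst r x bs).map .inl
  | .inr l, x, bs => (rsubstL l x bs).map .inr

/-- Left action of a permutation on a list:
`σ·(b₁,…,bₙ) = (b_{σ⁻¹(1)},…,b_{σ⁻¹(n)})` (identity if the length is not `n`). -/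
def permList {α : Type*} {n : ℕ} (σ : Equiv.Perm (Fin n)) (l : List α) : List α :=
  if h : l.length = n then List.ofFn (fun j : Fin n => l.get ((σ.symm j).cast h.symm))
  else l

/-! ### Symmetric multilinear substitution -/

/-- Symmetric multilinear substitution computed on rigid representatives:
`∑_{σ ∈ S_n} |r[σ·b⃗/x]|`, as a finite ℕ-linear sum of resource expressions. -/
noncomputable def dsubRig (x : ℕ) (r : REx) (bs : List Rt) : ResExpr →₀ ℕ :=
  ∑ σ : Equiv.Perm (Fin bs.length),
    (rsubstE r x (permList σ bs)).elim 0 (fun u => Finsupp.single (toQ u) 1)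

/-- The symmetric multilinear substitution `∂_x e · t̄`, a finite ℕ-linear sum
of resource expressions. -/
noncomputable def dsub (x : ℕ) (e : ResExpr) (t : Multiset ResTerm) : ResExpr →₀ ℕ :=
  dsubRig x (outE e) (t.toList.map rout)

/-! ### Multiplicity coefficients -/

/-- The factor `∏ᵢ kᵢ!` of the multiplicity of a rigid monomial, where the `kᵢ`
are the multiplicities of the pairwise distinct resource terms represented in it. -/
noncomputable def stabFac (bs : List Rt) : ℕ :=
  letI := Classical.decEq ResTerm
  (toMul bs).toFinset.prod fun t => Nat.factorial ((toMul bs).count t)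

/-- Multiplicity coefficient of a rigid term; for a monomial representing
`[t₁]^{k₁}·…·[tₚ]^{kₚ}` (the `tᵢ` pairwise distinct) the factor contributed is
`∏ᵢ kᵢ! · m(tᵢ)^{kᵢ} = (∏ᵢ kᵢ!) · ∏_{b ∈ b⃗} m(b)`. -/
noncomputable def mRig : Rt → ℕ
  | .var _ => 1
  | .lam a => mRig a
  | .inl a => mRig a
  | .inr a => mRig a
  | .app c ds => mRig c * (stabFac ds * (ds.attach.map fun e => mRig e.1).prod)
termination_by r => sizeOf r
decreasing_by
  all_goals simp_wf
  all_goals try omega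
  all_goals (have := List.sizeOf_lt_of_mem e.2; omega)

/-- Multiplicity coefficient `m(s)` of a resource term. -/
noncomputable def mT (s : ResTerm) : ℕ := mRig (rout s)

/-- Multiplicity coefficient `m(t̄) = ∏ᵢ kᵢ! · m(tᵢ)^{kᵢ}` of a resource
monomial `[t₁]^{k₁}·…·[tₚ]^{kₚ}` with the `tᵢ` pairwise distinct. -/
noncomputable def mMon (m : Multiset ResTerm) : ℕ :=
  letI := Classical.decEq ResTerm
  m.toFinset.prod fun t => Nat.factorial (m.count t) * (mT t) ^ (m.count t)

/-- Multiplicity coefficient of a resource expression. -/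
noncomputable def mE : ResExpr → ℕ := Sum.elim mT mMon


/-! ### Permutations of lists -/

section Permutations

open scoped List

theorem List.Perm.exists_map_eq {α β γ : Type*} {f : α → γ} {g : β → γ} {l : List α}
    {l' : List β} (h : l.map f ~ l'.map g) : ∃ k, k ~ l ∧ k.map f = l'.map g := by
  have h1 : List.Forall₂ (fun b a => f a = b) (l.map f) l := by
    rw [List.forall₂_map_left_iff]
    exact List.forall₂_same.2 fun _ _ => rfl
  obtain ⟨k, hk, hk'⟩ := List.perm_comp_forall₂ h.symm h1
  refine ⟨k, hk', ?_⟩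
  rw [← List.forall₂_eq_eq_eq, List.forall₂_map_left_iff]
  exact hk.flip

theorem List.Perm.map_of_map {α β γ : Type*} {f : α → β} {g : α → γ} {l l' : List α}
    (h : l.map f ~ l'.map f) (hfg : ∀ a ∈ l, ∀ b ∈ l', f a = f b → g a = g b) :
    l.map g ~ l'.map g := by
  obtain ⟨k, hk, e⟩ := h.exists_map_eq
  refine (hk.map g).symm.trans (List.Perm.of_eq ?_)
  have hk' : ∀ a ∈ k, ∀ b ∈ l', f a = f b → g a = g b := fun a ha => hfg a (hk.mem_iff.1 ha)
  clear hk hfg h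
  induction k generalizing l' with
  | nil => cases l' <;> simp_all
  | cons a k ih =>
    cases l' with
    | nil => simp at e
    | cons b l' =>
      simp only [List.map_cons, List.cons.injEq] at e ⊢
      exact ⟨hk' a (by simp) b (by simp) e.1, ih e.2 fun a ha b hb =>
        hk' a (by simp [ha]) b (by simp [hb])⟩

open Classical in
theorem card_filter_eq_count_ofFn {α : Type*} {n : ℕ} (f : Fin n → α) (a : α) :
    Fintype.card {i // f i = a} = (List.ofFn f).count a := by
  rw [← Multiset.coe_count, ← Fin.univ_val_map, Multiset.count_map, Fintype.card_subtype]
  simp only [eq_comm (a := a)]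
  rfl

theorem exists_perm_of_ofFn_perm {α : Type*} {n : ℕ} {f g : Fin n → α}
    (h : List.ofFn f ~ List.ofFn g) : ∃ σ : Equiv.Perm (Fin n), ∀ i, g (σ i) = f i := by
  classical
  have key : ∀ a, Nonempty ({i // f i = a} ≃ {i // g i = a}) := fun a => by
    rw [← Fintype.card_eq, card_filter_eq_count_ofFn, card_filter_eq_count_ofFn]
    exact h.count_eq a
  let e := fun a => (key a).some
  exact ⟨Equiv.ofFiberEquiv e, fun i => Equiv.ofFiberEquiv_map e i⟩

/-- The product of the factorials of the multiplicities of a multiset. -/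
noncomputable def Multiset.stab {α : Type*} (m : Multiset α) : ℕ :=
  letI := Classical.decEq α
  m.toFinset.prod fun a => Nat.factorial (m.count a)

theorem Multiset.stab_pos {α : Type*} (m : Multiset α) : 0 < m.stab :=
  Finset.prod_pos fun _ _ => Nat.factorial_pos _

theorem permList_eq_ofFn {α : Type*} {n : ℕ} (σ : Equiv.Perm (Fin n)) (f : Fin n → α) :
    permList σ (List.ofFn f) = List.ofFn (f ∘ σ.symm) := by
  simp [permList, Function.comp_def]

theorem permList_map {α β : Type*} {n : ℕ} (σ : Equiv.Perm (Fin n)) (f : α → β) (l : List α) :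
    permList σ (l.map f) = (permList σ l).map f := by
  by_cases h : l.length = n
  · subst h
    simp [permList, Function.comp_def]
  · simp [permList, h]

theorem card_perm_ofFn {α : Type*} {n : ℕ} (f g : Fin n → α) (h : List.ofFn g ~ List.ofFn f) :
    Nat.card {σ : Equiv.Perm (Fin n) // f ∘ σ.symm = g} = (Multiset.ofList (List.ofFn f)).stab := by
  classical
  obtain ⟨τ, hτ⟩ := exists_perm_of_ofFn_perm h
  have e : {σ : Equiv.Perm (Fin n) // f ∘ σ.symm = g} ≃ {σ : Equiv.Perm (Fin n) // f ∘ σ = f} :=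
    ((Equiv.inv _).trans (Equiv.mulRight τ⁻¹)).subtypeEquiv fun σ => by
      constructor
      · rintro h
        funext i
        have h1 := congrFun h (τ⁻¹ i)
        rw [← hτ] at h1
        simpa using h1
      · rintro h
        funext i
        have h1 := congrFun h (τ i)
        rw [hτ] at h1
        simpa using h1
  rw [Nat.card_congr e, Nat.card_eq_fintype_card, DomMulAct.stabilizer_card', Multiset.stab]
  refine Finset.prod_congr ?_ fun a _ => ?_
  · ext a; simp
  · rw [Multiset.coe_count, ← card_filter_eq_count_ofFn]

theorem card_permList {α : Type*} {n : ℕ} (l : List α) (hl : l.length = n) (P : List α → Prop) :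
    Nat.card {σ : Equiv.Perm (Fin n) // P (permList σ l)} =
      Nat.card {w : List α // w ~ l ∧ P w} * (Multiset.ofList l).stab := by
  obtain ⟨f, rfl⟩ : ∃ f : Fin n → α, l = List.ofFn f := by
    subst hl; exact ⟨l.get, by simp⟩
  simp only [permList_eq_ofFn]
  let e : {σ : Equiv.Perm (Fin n) // P (List.ofFn (f ∘ σ.symm))} ≃
      (w : {w : List α // w ~ List.ofFn f ∧ P w}) ×
        {σ : Equiv.Perm (Fin n) // List.ofFn (f ∘ σ.symm) = w.1} :=
    { toFun := fun σ => ⟨⟨_, Equiv.Perm.ofFn_comp_perm _ _, σ.2⟩, σ.1, rfl⟩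
      invFun := fun p => ⟨p.2.1, by rw [p.2.2]; exact p.1.2.2⟩
      left_inv := fun σ => rfl
      right_inv := by rintro ⟨⟨w, hw⟩, σ, h⟩
                      obtain rfl : _ = w := h
                      rfl }
  have hfin : Finite {w : List α // w ~ List.ofFn f ∧ P w} := by
    refine Set.Finite.to_subtype (s := {w | w ~ List.ofFn f ∧ P w}) ?_
    refine (List.finite_toSet (List.permutations (List.ofFn f))).subset ?_
    rintro w ⟨hw, -⟩
    simpa using hw
  have := Fintype.ofFinite {w : List α // w ~ List.ofFn f ∧ P w}
  rw [Nat.card_congr e, Nat.card_sigma, Finset.sum_congr rfl (g := fun _ => (Multiset.ofList (List.ofFn f)).stab)]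
  · simp
  · rintro ⟨w, hw, -⟩ -
    obtain ⟨g, rfl⟩ : ∃ g : Fin n → α, w = List.ofFn g := by
      have hl : w.length = n := by simpa using hw.length_eq
      subst hl; exact ⟨w.get, by simp⟩
    rw [← card_perm_ofFn f g hw]
    exact Nat.card_congr (Equiv.subtypeEquivRight fun σ => List.ofFn_inj)

theorem card_matching {α β : Type*} (I : α → β → Prop) {U : List α} {W : List β}
    (hI : List.Forall₂ I U W)
    (hu : ∀ a ∈ U, ∀ a' ∈ U, ∀ v, I a v → I a' v → a = a') :
    Nat.card {w // w ~ W ∧ List.Forall₂ I U w} * (Multiset.ofList W).stab =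
      (Multiset.ofList U).stab := by
  rw [← card_permList W hI.length_eq.symm]
  have h1 : Nat.card {w // w ~ U ∧ w = U} = 1 := by
    have : Unique {w // w ~ U ∧ w = U} := ⟨⟨⟨U, .refl _, rfl⟩⟩, fun w => Subtype.ext w.2.2⟩
    exact Nat.card_unique
  rw [← one_mul (Multiset.ofList U).stab, ← h1, ← card_permList U rfl (fun w => w = U)]
  refine Nat.card_congr (Equiv.subtypeEquivRight fun σ => ?_)
  have hn := hI.length_eq
  obtain ⟨n, hn'⟩ : ∃ n, U.length = n := ⟨_, rfl⟩
  obtain ⟨f, rfl⟩ : ∃ f : Fin U.length → β, W = List.ofFn f :=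
    ⟨fun i => W.get (i.cast hn), by apply List.ext_get <;> simp [hn]⟩
  rw [List.forall₂_iff_get] at hI
  have hI : ∀ i : Fin U.length, I (U.get i) (f i) := fun i => by
    simpa using hI.2 i i.2 (by simp)
  rw [permList_eq_ofFn, permList, dif_pos rfl, List.forall₂_iff_get]
  constructor
  · rintro ⟨-, h⟩
    apply List.ext_get (by simp)
    intro i hi hi'
    have h2 := h i hi' (by simpa using hi')
    simp only [List.get_ofFn] at h2 ⊢
    exact hu _ (List.get_mem ..) _ (List.get_mem ..) _ (hI _) h2
  · intro h
    refine ⟨by simp, fun i hi hi' => ?_⟩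
    have h2 := hI (σ.symm ⟨i, hi⟩)
    have h3 : U.get (σ.symm ⟨i, hi⟩) = U.get ⟨i, hi⟩ := by
      have h4 := List.getElem_of_eq h (by simpa using hi)
      rw [List.getElem_ofFn] at h4
      exact h4
    rw [h3] at h2
    simpa using h2

end Permutations

/-! ### Isomorphism classes of rigid terms -/

section Isomorphism

open scoped List

theorem Rt.induct {P : Rt → Prop} (var : ∀ n, P (.var n)) (lam : ∀ a, P a → P (.lam a))
    (inl : ∀ a, P a → P (.inl a)) (inr : ∀ a, P a → P (.inr a))
    (app : ∀ c ds, P c → (∀ d ∈ ds, P d) → P (.app c ds)) (a : Rt) : P a :=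
  Rt.rec (motive_1 := P) (motive_2 := fun ds => ∀ d ∈ ds, P d) var lam app inl inr
    (by simp) (fun _ _ h hs => by simpa using ⟨h, hs⟩) a

theorem IsoM.of_forall₂ {ds ds' : List Rt} (h : List.Forall₂ IsoT ds ds') : IsoM ds ds' := by
  rw [List.forall₂_iff_get] at h
  exact .mk _ _ h.1.symm 1 fun i => h.2 i i.2 (h.1 ▸ i.2)

theorem IsoT.refl (a : Rt) : IsoT a a := by
  induction a using Rt.induct with
  | var n => exact .var n
  | lam a h => exact .lam h
  | inl a h => exact .inl h
  | inr a h => exact .inr h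
  | app c ds hc hd => exact .app hc (.of_forall₂ (List.forall₂_same.2 hd))

theorem IsoT.symm {a b : Rt} (h : IsoT a b) : IsoT b a := by
  induction a using Rt.induct generalizing b with
  | var n => cases h; exact .var n
  | lam a ih => cases h with | lam h => exact .lam (ih h)
  | inl a ih => cases h with | inl h => exact .inl (ih h)
  | inr a ih => cases h with | inr h => exact .inr (ih h)
  | app c ds hc hd =>
    cases h with
    | app h1 h2 =>
      obtain ⟨_, ds', hl, σ, H⟩ := h2
      refine .app (hc h1) (.mk _ _ hl.symm
        ((finCongr hl).trans (σ.symm.trans (finCongr hl.symm))) fun i => ?_)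
      have h3 := H (σ.symm (i.cast hl))
      simp only [Equiv.apply_symm_apply] at h3
      exact hd _ (List.get_mem ..) h3

theorem IsoT.trans {a b c : Rt} (h : IsoT a b) (h' : IsoT b c) : IsoT a c := by
  induction a using Rt.induct generalizing b c with
  | var n => cases h; exact h'
  | lam a ih => cases h with | lam h => cases h' with | lam h' => exact .lam (ih h h')
  | inl a ih => cases h with | inl h => cases h' with | inl h' => exact .inl (ih h h')
  | inr a ih => cases h with | inr h => cases h' with | inr h' => exact .inr (ih h h')
  | app c ds hc hd =>
    cases h with
    | app h1 h2 =>
      cases h' with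
      | app h1' h2' =>
        obtain ⟨_, ds', hl, σ, H⟩ := h2
        obtain ⟨_, ds'', hl', σ', H'⟩ := h2'
        refine .app (hc h1 h1') (.mk _ _ (hl'.trans hl)
          (σ.trans ((finCongr hl.symm).trans (σ'.trans (finCongr hl)))) fun i => ?_)
        exact hd _ (List.get_mem ..) (H i) (H' _)

theorem rmk_eq_iff {a b : Rt} : rmk a = rmk b ↔ IsoT a b := by
  exact (Equivalence.mk IsoT.refl IsoT.symm IsoT.trans).quot_mk_eq_iff a b

theorem rmk_rout (s : ResTerm) : rmk (rout s) = s := Quot.out_eq s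

theorem map_rmk_rout (c : List ResTerm) : (c.map rout).map rmk = c := by
  simp [Function.comp_def, rmk_rout]

theorem toMul_eq_iff {ds ds' : List Rt} : toMul ds = toMul ds' ↔ IsoM ds ds' := by
  rw [toMul, toMul, Multiset.coe_eq_coe]
  constructor
  · intro h
    have hl : ds'.length = ds.length := by simpa using h.length_eq.symm
    obtain ⟨f, rfl⟩ : ∃ f : Fin ds.length → Rt, ds' = List.ofFn f :=
      ⟨fun i => ds'.get (i.cast hl.symm), by apply List.ext_get <;> simp [hl]⟩
    have h1 : List.ofFn (rmk ∘ ds.get) ~ List.ofFn (rmk ∘ f) := by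
      rw [← List.map_ofFn, ← List.map_ofFn, List.ofFn_get]
      exact h
    obtain ⟨σ, hσ⟩ := exists_perm_of_ofFn_perm h1
    refine .mk _ _ hl σ fun i => rmk_eq_iff.1 ?_
    simpa using (hσ i).symm
  · rintro ⟨_, _, hl, σ, H⟩
    obtain ⟨f, rfl⟩ : ∃ f : Fin ds.length → Rt, ds' = List.ofFn f :=
      ⟨fun i => ds'.get (i.cast hl.symm), by apply List.ext_get <;> simp [hl]⟩
    have h1 : ds.map rmk = List.ofFn ((rmk ∘ f) ∘ σ) := by
      apply List.ext_get (by simp)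
      intro i hi hi'
      have h2 := rmk_eq_iff.2 (H ⟨i, by simpa using hi⟩)
      simpa using h2
    rw [h1, List.map_ofFn]
    exact Equiv.Perm.ofFn_comp_perm _ _

theorem rmk_lam {a b : Rt} : rmk (.lam a) = rmk (.lam b) ↔ rmk a = rmk b := by
  simp only [rmk_eq_iff]
  exact ⟨fun h => by cases h; assumption, .lam⟩

theorem rmk_inl {a b : Rt} : rmk (.inl a) = rmk (.inl b) ↔ rmk a = rmk b := by
  simp only [rmk_eq_iff]
  exact ⟨fun h => by cases h; assumption, .inl⟩

theorem rmk_inr {a b : Rt} : rmk (.inr a) = rmk (.inr b) ↔ rmk a = rmk b := by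
  simp only [rmk_eq_iff]
  exact ⟨fun h => by cases h; assumption, .inr⟩

theorem rmk_app {a b : Rt} {ds ds' : List Rt} :
    rmk (.app a ds) = rmk (.app b ds') ↔ rmk a = rmk b ∧ toMul ds = toMul ds' := by
  simp only [rmk_eq_iff, toMul_eq_iff]
  exact ⟨fun h => by cases h; exact ⟨by assumption, by assumption⟩, fun h => .app h.1 h.2⟩

theorem rmk_var_eq {n : ℕ} {b : Rt} : rmk (.var n) = rmk b ↔ b = .var n := by
  simp only [rmk_eq_iff]
  exact ⟨fun h => by cases h; rfl, fun h => h ▸ .refl _⟩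

theorem rmk_lam_eq {a b : Rt} (h : rmk (.lam a) = rmk b) : ∃ b', b = .lam b' ∧ rmk a = rmk b' := by
  rw [rmk_eq_iff] at h
  cases h with | lam h => exact ⟨_, rfl, rmk_eq_iff.2 h⟩

theorem rmk_inl_eq {a b : Rt} (h : rmk (.inl a) = rmk b) : ∃ b', b = .inl b' ∧ rmk a = rmk b' := by
  rw [rmk_eq_iff] at h
  cases h with | inl h => exact ⟨_, rfl, rmk_eq_iff.2 h⟩

theorem rmk_inr_eq {a b : Rt} (h : rmk (.inr a) = rmk b) : ∃ b', b = .inr b' ∧ rmk a = rmk b' := by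
  rw [rmk_eq_iff] at h
  cases h with | inr h => exact ⟨_, rfl, rmk_eq_iff.2 h⟩

theorem rmk_app_eq {a b : Rt} {ds : List Rt} (h : rmk (.app a ds) = rmk b) :
    ∃ b' ds', b = .app b' ds' ∧ rmk a = rmk b' ∧ toMul ds = toMul ds' := by
  have h' := rmk_eq_iff.1 h
  cases h' with | app => exact ⟨_, _, rfl, rmk_app.1 h⟩

theorem mem_of_toMul_eq {ds ds' : List Rt} (h : toMul ds = toMul ds') {b : Rt} (hb : b ∈ ds') :
    ∃ d ∈ ds, rmk d = rmk b := by
  have h1 : rmk b ∈ toMul ds := h ▸ List.mem_map_of_mem hb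
  simpa using List.mem_map.1 (Multiset.mem_coe.1 h1)

theorem qLam_rmk (a : Rt) : qLam (rmk a) = rmk (.lam a) := rmk_lam.2 (rmk_rout _)

theorem qInl_rmk (a : Rt) : qInl (rmk a) = rmk (.inl a) := rmk_inl.2 (rmk_rout _)

theorem qInr_rmk (a : Rt) : qInr (rmk a) = rmk (.inr a) := rmk_inr.2 (rmk_rout _)

theorem toMul_rout (m : Multiset ResTerm) : toMul (m.toList.map rout) = m := by
  rw [toMul, map_rmk_rout, Multiset.coe_toList]

theorem qApp_rmk (a : Rt) (ds : List Rt) : qApp (rmk a) (toMul ds) = rmk (.app a ds) :=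
  rmk_app.2 ⟨rmk_rout _, toMul_rout _⟩

theorem qLam_inj {s s' : ResTerm} : qLam s = qLam s' ↔ s = s' := by
  rw [qLam, qLam, rmk_lam, rmk_rout, rmk_rout]

theorem qInl_inj {s s' : ResTerm} : qInl s = qInl s' ↔ s = s' := by
  rw [qInl, qInl, rmk_inl, rmk_rout, rmk_rout]

theorem qInr_inj {s s' : ResTerm} : qInr s = qInr s' ↔ s = s' := by
  rw [qInr, qInr, rmk_inr, rmk_rout, rmk_rout]

theorem qApp_inj {s s' : ResTerm} {m m' : Multiset ResTerm} :
    qApp s m = qApp s' m' ↔ s = s' ∧ m = m' := by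
  rw [qApp, qApp, rmk_app, rmk_rout, rmk_rout, toMul_rout, toMul_rout]

theorem qInl_ne_qInr (s s' : ResTerm) : qInl s ≠ qInr s' := by
  rw [qInl, qInr, Ne, rmk_eq_iff]
  intro h; cases h

/-! ### Coherence and isomorphism -/

theorem CohT.congr {a a' : Rt} (h : CohT a a') :
    ∀ {b b' : Rt}, rmk a = rmk b → rmk a' = rmk b' → CohT b b' := by
  refine CohT.rec (motive_1 := fun a a' _ => ∀ {b b'}, rmk a = rmk b → rmk a' = rmk b' → CohT b b')
    (motive_2 := fun ds ds' _ => ∀ {es es'}, toMul ds = toMul es → toMul ds' = toMul es' →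
      CohM es es') ?_ ?_ ?_ ?_ ?_ ?_ ?_ h
  · intro x b b' hb hb'
    rw [rmk_var_eq] at hb hb'
    subst hb hb'
    exact .var _
  · intro _ _ _ ih b b' hb hb'
    obtain ⟨b, rfl, e⟩ := rmk_lam_eq hb
    obtain ⟨b', rfl, e'⟩ := rmk_lam_eq hb'
    exact .lam (ih e e')
  · intro _ _ _ _ _ _ ih ih' b b' hb hb'
    obtain ⟨b, es, rfl, e, hes⟩ := rmk_app_eq hb
    obtain ⟨b', es', rfl, e', hes'⟩ := rmk_app_eq hb'
    exact .app (ih e e') (ih' hes hes')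
  · intro _ _ _ ih b b' hb hb'
    obtain ⟨b, rfl, e⟩ := rmk_inl_eq hb
    obtain ⟨b', rfl, e'⟩ := rmk_inl_eq hb'
    exact .inl (ih e e')
  · intro _ _ _ ih b b' hb hb'
    obtain ⟨b, rfl, e⟩ := rmk_inr_eq hb
    obtain ⟨b', rfl, e'⟩ := rmk_inr_eq hb'
    exact .inr (ih e e')
  · intro _ _ b b' hb hb'
    obtain ⟨b, rfl, e⟩ := rmk_inl_eq hb
    obtain ⟨b', rfl, e'⟩ := rmk_inr_eq hb'
    exact .mix _ _
  · intro ds ds' _ ih es es' hes hes'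
    have key : ∀ b ∈ es ++ es', ∃ d ∈ ds ++ ds', rmk d = rmk b := by
      intro b hb
      rw [List.mem_append] at hb
      rcases hb with hb | hb
      · obtain ⟨d, hd, e⟩ := mem_of_toMul_eq hes hb
        exact ⟨d, by simp [hd], e⟩
      · obtain ⟨d, hd, e⟩ := mem_of_toMul_eq hes' hb
        exact ⟨d, by simp [hd], e⟩
    refine .mk fun b hb b' hb' => ?_
    obtain ⟨d, hd, e⟩ := key b hb
    obtain ⟨d', hd', e'⟩ := key b' hb'
    exact ih d hd d' hd' e e'

theorem CohM.congr {ds ds' es es' : List Rt} (h : CohM ds ds') (he : toMul ds = toMul es)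
    (he' : toMul ds' = toMul es') : CohM es es' := by
  have h1 := (CohT.app (.var 0) h).congr (rmk_app.2 ⟨rfl, he⟩) (rmk_app.2 ⟨rfl, he'⟩)
  cases h1; assumption

end Isomorphism

/-! ### Shifting and multiplicity on isomorphism classes -/

section Quotient

open scoped List

theorem Rt.shiftR_app (k : ℕ) (c : Rt) (ds : List Rt) :
    (Rt.app c ds).shiftR k = .app (c.shiftR k) (ds.map (Rt.shiftR k)) := by
  rw [Rt.shiftR, List.attach_map_val (f := Rt.shiftR k)]

theorem nx_app (x : ℕ) (c : Rt) (ds : List Rt) : nx x (.app c ds) = nx x c + nxL x ds := by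
  rw [nx, List.attach_map_val (f := nx x), nxL]

theorem mRig_app (c : Rt) (ds : List Rt) :
    mRig (.app c ds) = mRig c * ((toMul ds).stab * (ds.map mRig).prod) := by
  rw [mRig, List.attach_map_val (f := mRig)]
  rfl

theorem toMul_eq_iff_perm {ds ds' : List Rt} : toMul ds = toMul ds' ↔ ds.map rmk ~ ds'.map rmk :=
  Multiset.coe_eq_coe

theorem rmk_shiftR {a b : Rt} (k : ℕ) :
    rmk (a.shiftR k) = rmk (b.shiftR k) ↔ rmk a = rmk b := by
  constructor
  · intro h
    induction a using Rt.induct generalizing b k with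
    | var n =>
      rw [Rt.shiftR, rmk_var_eq] at h
      cases b <;> simp only [Rt.shiftR, reduceCtorEq, Rt.shiftR_app, Rt.var.injEq] at h
      rw [rmk_var_eq, Rt.var.injEq]
      grind
    | lam a ih =>
      rw [Rt.shiftR] at h
      obtain ⟨b', e, h⟩ := rmk_lam_eq h
      cases b <;> simp only [Rt.shiftR, reduceCtorEq, Rt.shiftR_app, Rt.lam.injEq] at e
      subst e
      exact rmk_lam.2 (ih _ h)
    | inl a ih =>
      rw [Rt.shiftR] at h
      obtain ⟨b', e, h⟩ := rmk_inl_eq h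
      cases b <;> simp only [Rt.shiftR, reduceCtorEq, Rt.shiftR_app, Rt.inl.injEq] at e
      subst e
      exact rmk_inl.2 (ih _ h)
    | inr a ih =>
      rw [Rt.shiftR] at h
      obtain ⟨b', e, h⟩ := rmk_inr_eq h
      cases b <;> simp only [Rt.shiftR, reduceCtorEq, Rt.shiftR_app, Rt.inr.injEq] at e
      subst e
      exact rmk_inr.2 (ih _ h)
    | app c ds hc hd =>
      rw [Rt.shiftR_app] at h
      obtain ⟨b', ds', e, h, h'⟩ := rmk_app_eq h
      cases b <;> simp only [Rt.shiftR, reduceCtorEq, Rt.shiftR_app, Rt.app.injEq] at e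
      obtain ⟨rfl, rfl⟩ := e
      rw [toMul_eq_iff_perm, List.map_map, List.map_map] at h'
      exact rmk_app.2 ⟨hc _ h, toMul_eq_iff_perm.2 (h'.map_of_map fun a ha b _ => hd a ha k)⟩
  · intro h
    induction a using Rt.induct generalizing b k with
    | var n => rw [rmk_var_eq] at h; rw [h]
    | lam a ih =>
      obtain ⟨b, rfl, e⟩ := rmk_lam_eq h
      simpa only [Rt.shiftR, rmk_lam] using ih _ e
    | inl a ih =>
      obtain ⟨b, rfl, e⟩ := rmk_inl_eq h
      simpa only [Rt.shiftR, rmk_inl] using ih _ e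
    | inr a ih =>
      obtain ⟨b, rfl, e⟩ := rmk_inr_eq h
      simpa only [Rt.shiftR, rmk_inr] using ih _ e
    | app c ds hc hd =>
      obtain ⟨b, es, rfl, h, h'⟩ := rmk_app_eq h
      rw [toMul_eq_iff_perm] at h'
      rw [Rt.shiftR_app, Rt.shiftR_app, rmk_app, toMul_eq_iff_perm, List.map_map, List.map_map]
      exact ⟨hc _ h, h'.map_of_map fun a ha b _ => hd a ha k⟩

theorem mRig_congr {a b : Rt} (h : rmk a = rmk b) : mRig a = mRig b := by
  induction a using Rt.induct generalizing b with
  | var n => rw [rmk_var_eq] at h; rw [h]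
  | lam a ih =>
    obtain ⟨b, rfl, e⟩ := rmk_lam_eq h
    simpa only [mRig] using ih e
  | inl a ih =>
    obtain ⟨b, rfl, e⟩ := rmk_inl_eq h
    simpa only [mRig] using ih e
  | inr a ih =>
    obtain ⟨b, rfl, e⟩ := rmk_inr_eq h
    simpa only [mRig] using ih e
  | app c ds hc hd =>
    obtain ⟨b, es, rfl, h, h'⟩ := rmk_app_eq h
    rw [mRig_app, mRig_app, hc h, h']
    rw [toMul_eq_iff_perm] at h'
    rw [(h'.map_of_map (g := mRig) fun a ha b _ => hd a ha).prod_eq]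

/-- Shifting of the free variables `≥ k` of a resource term. -/
noncomputable def qShift (k : ℕ) (s : ResTerm) : ResTerm := rmk ((rout s).shiftR k)

theorem qShift_rmk (k : ℕ) (a : Rt) : qShift k (rmk a) = rmk (a.shiftR k) :=
  (rmk_shiftR k).2 (rmk_rout _)

theorem qShift_injective (k : ℕ) : Function.Injective (qShift k) := fun s s' h => by
  rw [qShift, qShift, rmk_shiftR, rmk_rout, rmk_rout] at h
  exact h

theorem Multiset.stab_map {α β : Type*} {f : α → β} (hf : f.Injective) (m : Multiset α) :
    (m.map f).stab = m.stab := by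
  classical
  rw [Multiset.stab, Multiset.stab, Multiset.toFinset_map, Finset.prod_image hf.injOn]
  exact Finset.prod_congr rfl fun a _ => by rw [Multiset.count_map_eq_count' f m hf]

theorem toMul_map_shiftR (k : ℕ) (ds : List Rt) :
    toMul (ds.map (Rt.shiftR k)) = (toMul ds).map (qShift k) := by
  simp [toMul, Function.comp_def, qShift_rmk]

theorem mRig_shiftR (a : Rt) (k : ℕ) : mRig (a.shiftR k) = mRig a := by
  induction a using Rt.induct generalizing k with
  | var n => simp only [Rt.shiftR, mRig]
  | lam a ih => simp only [Rt.shiftR, mRig, ih]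
  | inl a ih => simp only [Rt.shiftR, mRig, ih]
  | inr a ih => simp only [Rt.shiftR, mRig, ih]
  | app c ds hc hd =>
    rw [Rt.shiftR_app, mRig_app, mRig_app, hc, List.map_map]
    have h1 : ds.map (mRig ∘ Rt.shiftR k) = ds.map mRig :=
      List.map_congr_left fun d h => hd d h k
    have h2 : (toMul (ds.map (Rt.shiftR k))).stab = (toMul ds).stab := by
      rw [toMul_map_shiftR, Multiset.stab_map (qShift_injective k)]
    rw [h1, h2]

theorem mT_rmk (a : Rt) : mT (rmk a) = mRig a := mRig_congr (rmk_rout _)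

theorem mMon_eq (m : Multiset ResTerm) : mMon m = m.stab * (m.map mT).prod := by
  classical
  rw [mMon, Finset.prod_mul_distrib, Finset.prod_multiset_map_count]
  unfold Multiset.stab
  congr!

theorem mT_qLam (s : ResTerm) : mT (qLam s) = mT s := by
  rw [qLam, mT_rmk, mRig]; rfl

theorem mT_qInl (s : ResTerm) : mT (qInl s) = mT s := by
  rw [qInl, mT_rmk, mRig]; rfl

theorem mT_qInr (s : ResTerm) : mT (qInr s) = mT s := by
  rw [qInr, mT_rmk, mRig]; rfl

theorem mT_qApp (s : ResTerm) (m : Multiset ResTerm) : mT (qApp s m) = mT s * mMon m := by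
  have h : (m.map mT).prod = ((m.toList.map rout).map mRig).prod := by
    conv_lhs => rw [← Multiset.coe_toList m]
    simp only [Multiset.map_coe, Multiset.prod_coe, List.map_map]
    rfl
  rw [qApp, mT_rmk, mRig_app, mMon_eq, toMul_rout, h, mT]

theorem mRig_pos (a : Rt) : 0 < mRig a := by
  induction a using Rt.induct with
  | var n => simp [mRig]
  | lam a ih => simpa only [mRig] using ih
  | inl a ih => simpa only [mRig] using ih
  | inr a ih => simpa only [mRig] using ih
  | app c ds hc hd =>
    rw [mRig_app]
    refine Nat.mul_pos hc (Nat.mul_pos (Multiset.stab_pos _) (List.prod_pos ?_))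
    simpa using hd

theorem mT_pos (s : ResTerm) : 0 < mT s := mRig_pos _

theorem mMon_pos (m : Multiset ResTerm) : 0 < mMon m := by
  rw [mMon_eq]
  refine Nat.mul_pos (Multiset.stab_pos _) (Multiset.prod_pos ?_)
  simp [mT_pos]

theorem mT_qShift (k : ℕ) (s : ResTerm) : mT (qShift k s) = mT s := by
  rw [qShift, mT_rmk, mRig_shiftR]; rfl

/-! ### Substitution of resource terms in rigid expressions -/

mutual

theorem rsubst_congr (r : Rt) (x : ℕ) (bs bs' : List Rt) (h : bs.map rmk = bs'.map rmk) :
    (rsubst r x bs).map rmk = (rsubst r x bs').map rmk := by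
  match r with
  | .var n =>
    match bs, bs' with
    | [], [] => rfl
    | [], _ :: _ => simp at h
    | _ :: _, [] => simp at h
    | [b], [b'] => by_cases hn : n = x <;> simp_all [rsubst]
    | _ :: _ :: _, [_] => simp at h
    | [_], _ :: _ :: _ => simp at h
    | _ :: _ :: _, _ :: _ :: _ => by_cases hn : n = x <;> simp [rsubst, hn]
  | .lam a =>
    have ih := rsubst_congr a (x + 1) (bs.map (Rt.shiftR 0)) (bs'.map (Rt.shiftR 0)) (by
      simpa [Function.comp_def, ← qShift_rmk] using congrArg (List.map (qShift 0)) h)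
    have ih := congrArg (Option.map qLam) ih
    simpa [rsubst, Function.comp_def, qLam_rmk] using ih
  | .inl a =>
    have ih := congrArg (Option.map qInl) (rsubst_congr a x bs bs' h)
    simpa [rsubst, Function.comp_def, qInl_rmk] using ih
  | .inr a =>
    have ih := congrArg (Option.map qInr) (rsubst_congr a x bs bs' h)
    simpa [rsubst, Function.comp_def, qInr_rmk] using ih
  | .app c ds =>
    have ih := rsubst_congr c x (bs.take (nx x c)) (bs'.take (nx x c)) (by
      rw [List.map_take, List.map_take, h])
    have ih' := rsubstL_congr ds x (bs.drop (nx x c)) (bs'.drop (nx x c)) (by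
      rw [List.map_drop, List.map_drop, h])
    simp only [rsubst]
    revert ih ih'
    generalize rsubst c x (bs.take (nx x c)) = p
    generalize rsubst c x (bs'.take (nx x c)) = p'
    generalize rsubstL ds x (bs.drop (nx x c)) = q
    generalize rsubstL ds x (bs'.drop (nx x c)) = q'
    intro ih ih'
    cases p <;> cases p' <;> cases q <;> cases q' <;> simp_all [rmk_app, toMul]

theorem rsubstL_congr (l : List Rt) (x : ℕ) (bs bs' : List Rt) (h : bs.map rmk = bs'.map rmk) :
    (rsubstL l x bs).map (List.map rmk) = (rsubstL l x bs').map (List.map rmk) := by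
  match l with
  | [] =>
    match bs, bs' with
    | [], [] => rfl
    | [], _ :: _ => simp at h
    | _ :: _, [] => simp at h
    | _ :: _, _ :: _ => rfl
  | a :: as =>
    have ih := rsubst_congr a x (bs.take (nx x a)) (bs'.take (nx x a)) (by
      rw [List.map_take, List.map_take, h])
    have ih' := rsubstL_congr as x (bs.drop (nx x a)) (bs'.drop (nx x a)) (by
      rw [List.map_drop, List.map_drop, h])
    simp only [rsubstL]
    revert ih ih'
    generalize rsubst a x (bs.take (nx x a)) = p
    generalize rsubst a x (bs'.take (nx x a)) = p'
    generalize rsubstL as x (bs.drop (nx x a)) = q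
    generalize rsubstL as x (bs'.drop (nx x a)) = q'
    intro ih ih'
    cases p <;> cases p' <;> cases q <;> cases q' <;> simp_all

end

/-- Substitution of a list of resource terms for the occurrences of a variable in a rigid term. -/
noncomputable def qsubst (r : Rt) (x : ℕ) (c : List ResTerm) : Option ResTerm :=
  (rsubst r x (c.map rout)).map rmk

/-- Substitution of a list of resource terms for the occurrences of a variable in a rigid
monomial. -/
noncomputable def qsubstL (l : List Rt) (x : ℕ) (c : List ResTerm) : Option (List ResTerm) :=
  (rsubstL l x (c.map rout)).map (List.map rmk)

theorem rsubst_map_rmk (r : Rt) (x : ℕ) (bs : List Rt) :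
    (rsubst r x bs).map rmk = qsubst r x (bs.map rmk) :=
  rsubst_congr _ _ _ _ (map_rmk_rout _).symm

theorem rsubstL_map_rmk (l : List Rt) (x : ℕ) (bs : List Rt) :
    (rsubstL l x bs).map (List.map rmk) = qsubstL l x (bs.map rmk) :=
  rsubstL_congr _ _ _ _ (map_rmk_rout _).symm

theorem qsubst_var_self (x : ℕ) (c : List ResTerm) (v : ResTerm) :
    qsubst (.var x) x c = some v ↔ c = [v] := by
  match c with
  | [] => simp [qsubst, rsubst]
  | [b] => simp [qsubst, rsubst, rmk_rout]
  | _ :: _ :: _ => simp [qsubst, rsubst]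

theorem qsubst_var_ne {n x : ℕ} (h : n ≠ x) (c : List ResTerm) (v : ResTerm) :
    qsubst (.var n) x c = some v ↔ c = [] ∧ v = rmk (.var (if x < n then n - 1 else n)) := by
  match c with
  | [] => simp [qsubst, rsubst, h, eq_comm]
  | _ :: _ => simp [qsubst, rsubst, h]

theorem qsubst_lam (a : Rt) (x : ℕ) (c : List ResTerm) :
    qsubst (.lam a) x c = (qsubst a (x + 1) (c.map (qShift 0))).map qLam := by
  have h : c.map (qShift 0) = ((c.map rout).map (Rt.shiftR 0)).map rmk := by
    simp [Function.comp_def, qShift]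
  rw [h, ← rsubst_map_rmk, qsubst, rsubst]
  simp [Function.comp_def, qLam_rmk]

theorem qsubst_inl (a : Rt) (x : ℕ) (c : List ResTerm) :
    qsubst (.inl a) x c = (qsubst a x c).map qInl := by
  rw [qsubst, rsubst, qsubst]
  simp [Function.comp_def, qInl_rmk]

theorem qsubst_inr (a : Rt) (x : ℕ) (c : List ResTerm) :
    qsubst (.inr a) x c = (qsubst a x c).map qInr := by
  rw [qsubst, rsubst, qsubst]
  simp [Function.comp_def, qInr_rmk]

theorem qsubst_app_take (a : Rt) (ds : List Rt) (x : ℕ) (c : List ResTerm) (v : ResTerm) :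
    qsubst (.app a ds) x c = some v ↔ ∃ v₁ w, qsubst a x (c.take (nx x a)) = some v₁ ∧
      qsubstL ds x (c.drop (nx x a)) = some w ∧ v = qApp v₁ ↑w := by
  rw [qsubst, rsubst, qsubst, qsubstL, List.map_take, List.map_drop]
  generalize rsubst a x _ = p
  generalize rsubstL ds x _ = q
  cases p <;> cases q <;> simp [eq_comm, ← qApp_rmk, toMul]

theorem qsubstL_nil (x : ℕ) (c w : List ResTerm) :
    qsubstL [] x c = some w ↔ c = [] ∧ w = [] := by
  rw [qsubstL, rsubstL.eq_def]
  match c with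
  | [] => simp [eq_comm]
  | _ :: _ => simp

theorem qsubstL_cons_take (a : Rt) (as : List Rt) (x : ℕ) (c w : List ResTerm) :
    qsubstL (a :: as) x c = some w ↔ ∃ v w', qsubst a x (c.take (nx x a)) = some v ∧
      qsubstL as x (c.drop (nx x a)) = some w' ∧ w = v :: w' := by
  rw [qsubstL, rsubstL, qsubst, qsubstL, List.map_take, List.map_drop]
  generalize rsubst a x _ = p
  generalize rsubstL as x _ = q
  cases p <;> cases q <;> simp [eq_comm]

theorem qsubstL_length_of_forall {as : List Rt}
    (h : ∀ a ∈ as, ∀ x c v, qsubst a x c = some v → c.length = nx x a)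
    {x : ℕ} {c w : List ResTerm} (hw : qsubstL as x c = some w) : c.length = nxL x as := by
  induction as generalizing c w with
  | nil => simp [((qsubstL_nil ..).1 hw).1, nxL]
  | cons a as ih =>
    obtain ⟨v, w', h1, h2, -⟩ := (qsubstL_cons_take ..).1 hw
    have h3 := h a (by simp) _ _ _ h1
    have h4 := ih (fun a ha => h a (by simp [ha])) h2
    simp only [List.length_take, List.length_drop] at h3 h4
    simp only [nxL, List.map_cons, List.sum_cons] at h4 ⊢
    omega

theorem qsubst_length {a : Rt} {x : ℕ} {c : List ResTerm} {v : ResTerm}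
    (h : qsubst a x c = some v) : c.length = nx x a := by
  induction a using Rt.induct generalizing x c v with
  | var n =>
    by_cases hn : n = x
    · subst hn
      rw [qsubst_var_self] at h
      simp [h, nx]
    · rw [qsubst_var_ne hn] at h
      simp [h.1, nx, hn]
  | lam a ih =>
    rw [qsubst_lam, Option.map_eq_some_iff] at h
    obtain ⟨_, h, -⟩ := h
    simpa [nx] using ih h
  | inl a ih =>
    rw [qsubst_inl, Option.map_eq_some_iff] at h
    obtain ⟨_, h, -⟩ := h
    simpa [nx] using ih h
  | inr a ih =>
    rw [qsubst_inr, Option.map_eq_some_iff] at h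
    obtain ⟨_, h, -⟩ := h
    simpa [nx] using ih h
  | app b ds hb hd =>
    obtain ⟨v₁, w, h1, h2, -⟩ := (qsubst_app_take ..).1 h
    have h3 := hb h1
    have h4 := qsubstL_length_of_forall (fun d hm x c v => hd d hm) h2
    rw [nx_app]
    simp only [List.length_take, List.length_drop] at h3 h4
    omega

theorem qsubst_app (a : Rt) (ds : List Rt) (x : ℕ) (c : List ResTerm) (v : ResTerm) :
    qsubst (.app a ds) x c = some v ↔ ∃ c₁ c₂ v₁ w, c = c₁ ++ c₂ ∧ qsubst a x c₁ = some v₁ ∧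
      qsubstL ds x c₂ = some w ∧ v = qApp v₁ ↑w := by
  rw [qsubst_app_take]
  constructor
  · rintro ⟨v₁, w, h⟩
    exact ⟨_, _, v₁, w, (List.take_append_drop ..).symm, h⟩
  · rintro ⟨c₁, c₂, v₁, w, rfl, h1, h⟩
    refine ⟨v₁, w, ?_⟩
    rw [← qsubst_length h1, List.take_left, List.drop_left]
    exact ⟨h1, h⟩

theorem qsubstL_cons (a : Rt) (as : List Rt) (x : ℕ) (c w : List ResTerm) :
    qsubstL (a :: as) x c = some w ↔ ∃ c₁ c₂ v w', c = c₁ ++ c₂ ∧ qsubst a x c₁ = some v ∧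
      qsubstL as x c₂ = some w' ∧ w = v :: w' := by
  rw [qsubstL_cons_take]
  constructor
  · rintro ⟨v₁, w, h⟩
    exact ⟨_, _, v₁, w, (List.take_append_drop ..).symm, h⟩
  · rintro ⟨c₁, c₂, v₁, w, rfl, h1, h⟩
    refine ⟨v₁, w, ?_⟩
    rw [← qsubst_length h1, List.take_left, List.drop_left]
    exact ⟨h1, h⟩

end Quotient

/-! ### Coefficients of substitutions in uniform expressions -/

section Coefficients

open scoped List

theorem qsubstL_eq_some_iff {as : List Rt} {x : ℕ} {c w : List ResTerm} :
    qsubstL as x c = some w ↔ ∃ L : List (Rt × List ResTerm × ResTerm),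
      L.map (fun p => p.1) = as ∧ L.flatMap (fun p => p.2.1) = c ∧ L.map (fun p => p.2.2) = w ∧
        ∀ p ∈ L, qsubst p.1 x p.2.1 = some p.2.2 := by
  induction as generalizing c w with
  | nil =>
    rw [qsubstL_nil]
    constructor
    · rintro ⟨rfl, rfl⟩
      exact ⟨[], by simp⟩
    · rintro ⟨L, h, rfl, rfl, -⟩
      simp_all
  | cons a as ih =>
    rw [qsubstL_cons]
    constructor
    · rintro ⟨c₁, c₂, v, w', rfl, h, h', rfl⟩
      obtain ⟨L, rfl, rfl, rfl, hL⟩ := ih.1 h'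
      exact ⟨(a, c₁, v) :: L, by simpa using ⟨h, fun a b c => hL (a, b, c)⟩⟩
    · rintro ⟨_ | ⟨p, L⟩, h, rfl, rfl, hL⟩
      · simp at h
      · simp only [List.map_cons, List.cons.injEq] at h
        obtain ⟨rfl, rfl⟩ := h
        exact ⟨_, _, _, _, rfl, hL p (by simp), ih.2 ⟨L, rfl, rfl, rfl, fun q hq =>
          hL q (by simp [hq])⟩, rfl⟩

theorem perm_flatMap_of_map {α β : Type*} {f : α → List β} {L L' : List α}
    (h : L.map (fun a => Multiset.ofList (f a)) ~ L'.map (fun a => Multiset.ofList (f a))) :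
    L.flatMap f ~ L'.flatMap f := by
  have key : ∀ L : List α, (L.map fun a => Multiset.ofList (f a)).sum = ↑(L.flatMap f) := by
    intro L
    induction L with
    | nil => rfl
    | cons a L ih => simp [ih]
  rw [← Multiset.coe_eq_coe, ← key, ← key, h.sum_eq]

theorem qsubstL_unique_of_forall {as as' : List Rt} {x : ℕ} {c c' w w' : List ResTerm}
    (H : ∀ a ∈ as, ∀ a' ∈ as', ∀ c c' v, qsubst a x c = some v → qsubst a' x c' = some v →
      rmk a = rmk a' ∧ c ~ c')
    (h : qsubstL as x c = some w) (h' : qsubstL as' x c' = some w') (hw : w ~ w') :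
    toMul as = toMul as' ∧ c ~ c' := by
  obtain ⟨L, rfl, rfl, rfl, hL⟩ := qsubstL_eq_some_iff.1 h
  obtain ⟨L', rfl, rfl, rfl, hL'⟩ := qsubstL_eq_some_iff.1 h'
  have key : ∀ p ∈ L, ∀ q ∈ L', p.2.2 = q.2.2 → rmk p.1 = rmk q.1 ∧ p.2.1 ~ q.2.1 :=
    fun p hp q hq e => H _ (List.mem_map_of_mem hp) _ (List.mem_map_of_mem hq) _ _ _
      (hL p hp) (e ▸ hL' q hq)
  constructor
  · rw [toMul_eq_iff_perm, List.map_map, List.map_map]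
    exact hw.map_of_map fun p hp q hq e => (key p hp q hq e).1
  · exact perm_flatMap_of_map (hw.map_of_map fun p hp q hq e =>
      Multiset.coe_eq_coe.2 (key p hp q hq e).2)

/-- Coherent terms with a common substitution instance are isomorphic, and the substituted lists
agree up to a permutation. -/
theorem qsubst_unique {a a' : Rt} {x : ℕ} {c c' : List ResTerm} {v : ResTerm} (ha : CohT a a')
    (h : qsubst a x c = some v) (h' : qsubst a' x c' = some v) : rmk a = rmk a' ∧ c ~ c' := by
  induction a using Rt.induct generalizing a' x c c' v with
  | var n =>
    cases ha
    refine ⟨rfl, ?_⟩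
    by_cases hn : n = x
    · subst hn
      rw [qsubst_var_self] at h h'
      rw [h, h']
    · rw [qsubst_var_ne hn] at h h'
      rw [h.1, h'.1]
  | lam a ih =>
    cases ha with | lam ha =>
    rw [qsubst_lam, Option.map_eq_some_iff] at h h'
    obtain ⟨u, h, rfl⟩ := h
    obtain ⟨u', h', e⟩ := h'
    rw [qLam_inj] at e
    subst e
    have h1 := ih ha h h'
    exact ⟨rmk_lam.2 h1.1, (List.map_perm_map_iff (qShift_injective 0)).1 h1.2⟩
  | inl a ih =>
    rw [qsubst_inl, Option.map_eq_some_iff] at h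
    obtain ⟨u, h, rfl⟩ := h
    cases ha with
    | inl ha =>
      rw [qsubst_inl, Option.map_eq_some_iff] at h'
      obtain ⟨u', h', e⟩ := h'
      rw [qInl_inj] at e
      subst e
      have h1 := ih ha h h'
      exact ⟨rmk_inl.2 h1.1, h1.2⟩
    | mix =>
      rw [qsubst_inr, Option.map_eq_some_iff] at h'
      obtain ⟨u', h', e⟩ := h'
      exact absurd e.symm (qInl_ne_qInr _ _)
  | inr a ih =>
    cases ha with | inr ha =>
    rw [qsubst_inr, Option.map_eq_some_iff] at h h'
    obtain ⟨u, h, rfl⟩ := h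
    obtain ⟨u', h', e⟩ := h'
    rw [qInr_inj] at e
    subst e
    have h1 := ih ha h h'
    exact ⟨rmk_inr.2 h1.1, h1.2⟩
  | app b ds hb hd =>
    cases ha with | app ha hm =>
    cases hm with | mk hm =>
    rw [qsubst_app] at h h'
    obtain ⟨c₁, c₂, u, w, rfl, h1, h2, rfl⟩ := h
    obtain ⟨c₁', c₂', u', w', rfl, h1', h2', e⟩ := h'
    rw [qApp_inj, Multiset.coe_eq_coe] at e
    obtain ⟨rfl, e⟩ := e
    have h3 := hb ha h1 h1'
    have h4 := qsubstL_unique_of_forall (fun d hd1 d' hd' c c' v =>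
      hd d hd1 (hm d (by simp [hd1]) d' (by simp [hd']))) h2 h2' e
    exact ⟨rmk_app.2 ⟨h3.1, h4.1⟩, h3.2.append h4.2⟩

theorem qsubstL_unique {as as' : List Rt} {x : ℕ} {c c' w w' : List ResTerm} (ha : CohM as as')
    (h : qsubstL as x c = some w) (h' : qsubstL as' x c' = some w') (hw : w ~ w') :
    toMul as = toMul as' ∧ c ~ c' := by
  cases ha with | mk ha =>
  exact qsubstL_unique_of_forall (fun d hd d' hd' c c' v =>
    qsubst_unique (ha d (by simp [hd]) d' (by simp [hd']))) h h' hw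

theorem qsubstL_of_toMul_eq {as as' : List Rt} {x : ℕ} {c w : List ResTerm}
    (H : ∀ a ∈ as, ∀ a' ∈ as', rmk a = rmk a' → ∀ c v, qsubst a x c = some v →
      ∃ c', c' ~ c ∧ qsubst a' x c' = some v)
    (ha : toMul as = toMul as') (h : qsubstL as x c = some w) :
    ∃ c' w', c' ~ c ∧ w' ~ w ∧ qsubstL as' x c' = some w' := by
  obtain ⟨L, rfl, rfl, rfl, hL⟩ := qsubstL_eq_some_iff.1 h
  rw [toMul_eq_iff_perm, List.map_map] at ha
  obtain ⟨K, hK, e⟩ := ha.exists_map_eq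
  suffices ∃ c', c' ~ K.flatMap (fun p => p.2.1) ∧
      qsubstL as' x c' = some (K.map fun p => p.2.2) by
    obtain ⟨c', hc, h⟩ := this
    exact ⟨c', _, hc.trans (perm_flatMap_of_map (hK.map _)), hK.map _, h⟩
  have H' : ∀ p ∈ K, ∀ a' ∈ as', rmk p.1 = rmk a' →
      ∃ c', c' ~ p.2.1 ∧ qsubst a' x c' = some p.2.2 := fun p hp a' ha' he =>
    H _ (List.mem_map_of_mem (hK.mem_iff.1 hp)) a' ha' he _ _ (hL p (hK.mem_iff.1 hp))
  clear H ha h hL hK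
  induction as' generalizing K with
  | nil =>
    obtain rfl : K = [] := by simpa using e
    exact ⟨[], by simp [qsubstL_nil]⟩
  | cons a as ih =>
    obtain _ | ⟨p, K⟩ := K
    · simp at e
    · simp only [List.map_cons, List.cons.injEq, Function.comp_apply] at e
      obtain ⟨c₁, hc, h⟩ := H' p (by simp) a (by simp) e.1
      obtain ⟨c₂, hc', h'⟩ := ih K e.2 fun p hp a ha => H' p (by simp [hp]) a (by simp [ha])
      exact ⟨c₁ ++ c₂, hc.append hc', (qsubstL_cons ..).2 ⟨_, _, _, _, rfl, h, h', rfl⟩⟩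

theorem qsubst_of_rmk_eq {a a' : Rt} {x : ℕ} {c : List ResTerm} {v : ResTerm}
    (ha : rmk a = rmk a') (h : qsubst a x c = some v) :
    ∃ c', c' ~ c ∧ qsubst a' x c' = some v := by
  induction a using Rt.induct generalizing a' x c v with
  | var n =>
    rw [rmk_var_eq] at ha
    exact ⟨c, .refl _, ha ▸ h⟩
  | lam a ih =>
    obtain ⟨a', rfl, e⟩ := rmk_lam_eq ha
    rw [qsubst_lam, Option.map_eq_some_iff] at h
    obtain ⟨u, h, rfl⟩ := h
    obtain ⟨c', hc, h'⟩ := ih e h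
    obtain ⟨k, hk, e'⟩ := List.Perm.exists_map_eq (f := qShift 0) (g := id) (l' := c')
      (by simpa using hc.symm)
    rw [List.map_id] at e'
    refine ⟨k, hk, ?_⟩
    rw [qsubst_lam, e', h', Option.map_some]
  | inl a ih =>
    obtain ⟨a', rfl, e⟩ := rmk_inl_eq ha
    rw [qsubst_inl, Option.map_eq_some_iff] at h
    obtain ⟨u, h, rfl⟩ := h
    obtain ⟨c', hc, h'⟩ := ih e h
    exact ⟨c', hc, by rw [qsubst_inl, h', Option.map_some]⟩
  | inr a ih =>
    obtain ⟨a', rfl, e⟩ := rmk_inr_eq ha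
    rw [qsubst_inr, Option.map_eq_some_iff] at h
    obtain ⟨u, h, rfl⟩ := h
    obtain ⟨c', hc, h'⟩ := ih e h
    exact ⟨c', hc, by rw [qsubst_inr, h', Option.map_some]⟩
  | app b ds hb hd =>
    obtain ⟨b', ds', rfl, e, e'⟩ := rmk_app_eq ha
    rw [qsubst_app] at h
    obtain ⟨c₁, c₂, u, w, rfl, h1, h2, rfl⟩ := h
    obtain ⟨c₁', hc, h1'⟩ := hb e h1
    obtain ⟨c₂', w', hc', hw, h2'⟩ := qsubstL_of_toMul_eq (fun d hm d' _ e c v => hd d hm e) e' h2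
    exact ⟨c₁' ++ c₂', hc.append hc', (qsubst_app ..).2
      ⟨_, _, _, _, rfl, h1', h2', qApp_inj.2 ⟨rfl, Multiset.coe_eq_coe.2 hw.symm⟩⟩⟩

theorem card_append {α : Type*} {P Q : List α → Prop} {n : ℕ} (hP : ∀ c, P c → c.length = n) :
    Nat.card {c // ∃ c₁ c₂, c = c₁ ++ c₂ ∧ P c₁ ∧ Q c₂} =
      Nat.card {c // P c} * Nat.card {c // Q c} := by
  rw [← Nat.card_prod]
  refine (Nat.card_congr (Equiv.ofBijective
    (fun p => ⟨p.1.1 ++ p.2.1, _, _, rfl, p.1.2, p.2.2⟩) ⟨?_, ?_⟩)).symm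
  · rintro ⟨⟨c₁, h₁⟩, c₂, h₂⟩ ⟨⟨c₁', h₁'⟩, c₂', h₂'⟩ h
    simp only [Subtype.mk.injEq] at h
    have h3 := List.append_inj h ((hP _ h₁).trans (hP _ h₁').symm)
    simp [h3.1, h3.2]
  · rintro ⟨_, c₁, c₂, rfl, h₁, h₂⟩
    exact ⟨⟨⟨c₁, h₁⟩, c₂, h₂⟩, rfl⟩

theorem card_qsubstL_list {as : List Rt} {x : ℕ} {c w : List ResTerm}
    (H : ∀ a ∈ as, ∀ c v, qsubst a x c = some v →
      Nat.card {c // qsubst a x c = some v} * mT v = mRig a * (c.map mT).prod)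
    (h : qsubstL as x c = some w) :
    Nat.card {c // qsubstL as x c = some w} * (w.map mT).prod =
      (as.map mRig).prod * (c.map mT).prod := by
  induction as generalizing c w with
  | nil =>
    simp only [qsubstL_nil] at h ⊢
    obtain ⟨rfl, rfl⟩ := h
    simp
  | cons a as ih =>
    obtain ⟨c₁, c₂, v, w, rfl, h1, h2, rfl⟩ := (qsubstL_cons ..).1 h
    have h3 : ∀ c, qsubstL (a :: as) x c = some (v :: w) ↔ ∃ c₁ c₂, c = c₁ ++ c₂ ∧
        qsubst a x c₁ = some v ∧ qsubstL as x c₂ = some w := fun c => by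
      rw [qsubstL_cons]
      constructor
      · rintro ⟨c₁, c₂, v', w', rfl, h, h', e⟩
        obtain ⟨rfl, rfl⟩ := List.cons.inj e
        exact ⟨c₁, c₂, rfl, h, h'⟩
      · rintro ⟨c₁, c₂, rfl, h, h'⟩
        exact ⟨c₁, c₂, v, w, rfl, h, h', rfl⟩
    simp only [h3]
    rw [card_append fun _ => qsubst_length]
    have h4 := ih (fun a ha => H a (by simp [ha])) h2
    have h5 := H a (by simp) _ _ h1
    simp only [List.map_cons, List.prod_cons, List.map_append, List.prod_append]
    linear_combination (Nat.card {c // qsubst a x c = some v} * mT v) * h4 +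
      ((as.map mRig).prod * (c₂.map mT).prod) * h5

theorem forall₂_exists_qsubst_iff {as : List Rt} {x : ℕ} {w : List ResTerm} :
    List.Forall₂ (fun s v => ∃ c, qsubst (rout s) x c = some v) (as.map rmk) w ↔
      ∃ c, qsubstL as x c = some w := by
  induction as generalizing w with
  | nil => simp [qsubstL_nil]
  | cons a as ih =>
    simp only [List.map_cons, List.forall₂_cons_left_iff, ih, qsubstL_cons]
    constructor
    · rintro ⟨v, w', ⟨c, h⟩, ⟨c', h'⟩, rfl⟩
      obtain ⟨k, -, hk⟩ := qsubst_of_rmk_eq (rmk_rout _) h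
      exact ⟨_, _, _, _, _, rfl, hk, h', rfl⟩
    · rintro ⟨_, c₁, c₂, v, w', rfl, h, h', rfl⟩
      obtain ⟨k, -, hk⟩ := qsubst_of_rmk_eq (rmk_rout _).symm h
      exact ⟨v, w', ⟨k, hk⟩, ⟨c₂, h'⟩, rfl⟩

theorem mMon_toMul (as : List Rt) : mMon (toMul as) = (toMul as).stab * (as.map mRig).prod := by
  rw [mMon_eq, toMul, Multiset.map_coe, Multiset.prod_coe, List.map_map]
  congr 3
  exact funext mT_rmk

theorem mMon_coe (w : List ResTerm) :
    mMon ↑w = (Multiset.ofList w).stab * (w.map mT).prod := by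
  rw [mMon_eq, Multiset.map_coe, Multiset.prod_coe]

theorem card_qsubstL_of_forall {as : List Rt} {x : ℕ} {c w : List ResTerm} (ha : CohM as as)
    (H : ∀ a ∈ as, ∀ c v, qsubst a x c = some v →
      Nat.card {c // qsubst a x c = some v} * mT v = mRig a * (c.map mT).prod)
    (h : qsubstL as x c = some w) :
    Nat.card {c // ∃ w', qsubstL as x c = some w' ∧ w' ~ w} * mMon ↑w =
      mMon (toMul as) * (c.map mT).prod := by
  set I : ResTerm → ResTerm → Prop := fun s v => ∃ c, qsubst (rout s) x c = some v
  let e : {c // ∃ w', qsubstL as x c = some w' ∧ w' ~ w} ≃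
      (w' : {w' // w' ~ w ∧ List.Forall₂ I (as.map rmk) w'}) ×
        {c // qsubstL as x c = some w'.1} :=
    (Equiv.ofBijective (fun p => ⟨p.2.1, p.1.1, p.2.2, p.1.2.1⟩) (by
      constructor
      · rintro ⟨⟨w₁, h₁⟩, c₁, e₁⟩ ⟨⟨w₂, h₂⟩, c₂, e₂⟩ h
        obtain rfl : c₁ = c₂ := by simpa using h
        obtain rfl : w₁ = w₂ := Option.some.inj (e₁.symm.trans e₂)
        rfl
      · rintro ⟨c, w', h, h'⟩
        exact ⟨⟨⟨w', h', forall₂_exists_qsubst_iff.2 ⟨c, h⟩⟩, c, h⟩, rfl⟩)).symm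
  have hc : ∀ w' : {w' // w' ~ w ∧ List.Forall₂ I (as.map rmk) w'},
      Nat.card {c // qsubstL as x c = some w'.1} * (w.map mT).prod =
        (as.map mRig).prod * (c.map mT).prod := by
    rintro ⟨w', hw, h'⟩
    obtain ⟨c', h'⟩ := forall₂_exists_qsubst_iff.1 h'
    rw [← ((qsubstL_unique ha h' h hw).2.map mT).prod_eq, ← (hw.map mT).prod_eq]
    exact card_qsubstL_list H h'
  have hpos : 0 < (as.map mRig).prod * (c.map mT).prod :=
    Nat.mul_pos (List.prod_pos (by simp [mRig_pos])) (List.prod_pos (by simp [mT_pos]))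
  have hfin : ∀ w' : {w' // w' ~ w ∧ List.Forall₂ I (as.map rmk) w'},
      Finite {c // qsubstL as x c = some w'.1} := fun w' =>
    Nat.finite_of_card_ne_zero fun h0 => by
      have := hc w'
      rw [h0, zero_mul] at this
      omega
  have hmatch := card_matching I (forall₂_exists_qsubst_iff.2 ⟨c, h⟩) (by
    cases ha with | mk ha =>
    rintro s hs s' hs' v ⟨c, h⟩ ⟨c', h'⟩
    obtain ⟨a, ha1, rfl⟩ := List.mem_map.1 hs
    obtain ⟨a', ha2, rfl⟩ := List.mem_map.1 hs'
    obtain ⟨k, -, hk⟩ := qsubst_of_rmk_eq (rmk_rout _) h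
    obtain ⟨k', -, hk'⟩ := qsubst_of_rmk_eq (rmk_rout _) h'
    exact (qsubst_unique (ha a (by simp [ha1]) a' (by simp [ha2])) hk hk').1)
  have hfin' : Finite {w' // w' ~ w ∧ List.Forall₂ I (as.map rmk) w'} :=
    Nat.finite_of_card_ne_zero fun h0 => by
      rw [h0, zero_mul] at hmatch
      exact (Multiset.stab_pos _).ne hmatch
  have := Fintype.ofFinite {w' // w' ~ w ∧ List.Forall₂ I (as.map rmk) w'}
  rw [mMon_coe, mMon_toMul, toMul, ← hmatch, Nat.card_congr e, Nat.card_sigma,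
    mul_left_comm, Finset.sum_mul, Finset.sum_congr rfl fun w' _ => hc w', Finset.sum_const,
    Finset.card_univ, ← Nat.card_eq_fintype_card, smul_eq_mul]
  ring

theorem card_qsubst {a : Rt} {x : ℕ} {c : List ResTerm} {v : ResTerm} (ha : CohT a a)
    (h : qsubst a x c = some v) :
    Nat.card {c // qsubst a x c = some v} * mT v = mRig a * (c.map mT).prod := by
  induction a using Rt.induct generalizing x c v with
  | var n =>
    by_cases hn : n = x
    · subst hn
      simp only [qsubst_var_self] at h ⊢
      simp [h, mRig]
    · simp only [qsubst_var_ne hn] at h ⊢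
      obtain ⟨rfl, rfl⟩ := h
      simp [mRig, mT_rmk]
  | lam a ih =>
    cases ha with | lam ha =>
    simp only [qsubst_lam, Option.map_eq_some_iff] at h
    obtain ⟨u, h, rfl⟩ := h
    have h1 := ih ha h
    rw [mT_qLam, mRig]
    have h2 : (c.map (qShift 0)).map mT = c.map mT := by
      simp [Function.comp_def, mT_qShift]
    rw [← h2, ← h1]
    congr 1
    refine Nat.card_congr (Equiv.ofBijective (fun k => ⟨k.1.map (qShift 0), ?_⟩) ⟨?_, ?_⟩)
    · obtain ⟨k, hk⟩ := k
      simpa [qsubst_lam, qLam_inj] using hk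
    · rintro ⟨k, hk⟩ ⟨k', hk'⟩ e
      simp only [Subtype.mk.injEq] at e
      exact Subtype.ext ((qShift_injective 0).list_map e)
    · rintro ⟨k, hk⟩
      obtain ⟨l, -, e⟩ := List.Perm.exists_map_eq (f := qShift 0) (g := id) (l' := k)
        (by simpa using (qsubst_unique ha h hk).2)
      rw [List.map_id] at e
      subst e
      exact ⟨⟨l, by rw [qsubst_lam, hk, Option.map_some]⟩, rfl⟩
  | inl a ih =>
    cases ha with | inl ha =>
    simp only [qsubst_inl, Option.map_eq_some_iff] at h ⊢
    obtain ⟨u, h, rfl⟩ := h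
    simpa [qInl_inj, mT_qInl, mRig] using ih ha h
  | inr a ih =>
    cases ha with | inr ha =>
    simp only [qsubst_inr, Option.map_eq_some_iff] at h ⊢
    obtain ⟨u, h, rfl⟩ := h
    simpa [qInr_inj, mT_qInr, mRig] using ih ha h
  | app b ds hb hd =>
    cases ha with | app ha hm =>
    obtain ⟨c₁, c₂, u, w, rfl, h1, h2, rfl⟩ := (qsubst_app ..).1 h
    have h3 : ∀ c, qsubst (.app b ds) x c = some (qApp u ↑w) ↔ ∃ c₁ c₂, c = c₁ ++ c₂ ∧
        qsubst b x c₁ = some u ∧ ∃ w', qsubstL ds x c₂ = some w' ∧ w' ~ w := fun c => by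
      rw [qsubst_app]
      constructor
      · rintro ⟨c₁, c₂, v', w', rfl, h, h', e⟩
        rw [qApp_inj, Multiset.coe_eq_coe] at e
        exact ⟨c₁, c₂, rfl, e.1 ▸ h, w', h', e.2.symm⟩
      · rintro ⟨c₁, c₂, rfl, h, w', h', e⟩
        exact ⟨c₁, c₂, u, w', rfl, h, h', qApp_inj.2 ⟨rfl, Multiset.coe_eq_coe.2 e.symm⟩⟩
    simp only [h3]
    rw [card_append fun _ => qsubst_length, mT_qApp, mRig_app, ← mMon_toMul, List.map_append,
      List.prod_append]
    have h4 := hb ha h1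
    have h5 := card_qsubstL_of_forall hm (fun d hm' c v => by
      cases hm with | mk hm =>
      exact hd d hm' (hm d (by simp [hm']) d (by simp [hm']))) h2
    linear_combination (Nat.card {c // qsubst b x c = some u} * mT u) * h5 +
      (mMon (toMul ds) * (c₂.map mT).prod) * h4

theorem card_qsubstL {as : List Rt} {x : ℕ} {c w : List ResTerm} (ha : CohM as as)
    (h : qsubstL as x c = some w) :
    Nat.card {c // ∃ w', qsubstL as x c = some w' ∧ w' ~ w} * mMon ↑w =
      mMon (toMul as) * (c.map mT).prod :=
  card_qsubstL_of_forall ha (fun d hd c v => by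
    cases ha with | mk ha =>
    exact card_qsubst (ha d (by simp [hd]) d (by simp [hd]))) h

theorem dsubRig_apply (x : ℕ) (r : REx) (bs : List Rt) (e : ResExpr) (P : List ResTerm → Prop)
    (hP : ∀ bs, (∃ u, rsubstE r x bs = some u ∧ toQ u = e) ↔ P (bs.map rmk)) :
    dsubRig x r bs e =
      Nat.card {w : List ResTerm // w ~ bs.map rmk ∧ P w} * (toMul bs).stab := by
  classical
  rw [toMul, ← card_permList (n := bs.length) (bs.map rmk) (by simp) P, Nat.card_eq_fintype_card,
    Fintype.card_subtype, Finset.card_filter, dsubRig, Finsupp.finsetSum_apply]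
  refine Finset.sum_congr rfl fun σ _ => ?_
  rw [permList_map]
  simp only [← hP]
  cases rsubstE r x (permList σ bs) <;> simp [Finsupp.single_apply]

theorem dsubRig_mul_mE {x : ℕ} {r : REx} {t : Multiset ResTerm} {e : ResExpr} {k : ℕ}
    {P : List ResTerm → Prop}
    (hP : ∀ bs, (∃ u, rsubstE r x bs = some u ∧ toQ u = e) ↔ P (bs.map rmk))
    (hu : ∀ w w', P w → P w' → w ~ w')
    (hc : ∀ w, P w → Nat.card {w // P w} * mE e = k * (w.map mT).prod)
    (h0 : dsubRig x r (t.toList.map rout) e ≠ 0) :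
    dsubRig x r (t.toList.map rout) e * mE e = k * mMon t := by
  rw [dsubRig_apply x r _ e P hP, map_rmk_rout, toMul_rout] at h0 ⊢
  obtain ⟨⟨w, hw, hPw⟩⟩ : Nonempty {w : List ResTerm // w ~ t.toList ∧ P w} :=
    (Nat.card_pos_iff.1 (Nat.pos_of_ne_zero (left_ne_zero_of_mul h0))).1
  have h1 : ∀ w', w' ~ t.toList ∧ P w' ↔ P w' := fun w' =>
    ⟨And.right, fun h => ⟨(hu _ _ h hPw).trans hw, h⟩⟩
  simp only [h1]
  have h2 : (t.map mT).prod = (w.map mT).prod := by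
    rw [← Multiset.coe_toList t, ← Multiset.coe_eq_coe.2 hw, Multiset.map_coe, Multiset.prod_coe]
  rw [mMon_eq, h2]
  linear_combination t.stab * hc w hPw

end Coefficients

/-! ### STATEMENT 17:
Let `e` be a uniform resource expression (`e ¨ e`) and `t̄` a resource monomial.
For every `e'` in the support of `∂_x e · t̄`, the coefficient of `e'` in
`∂_x e · t̄` equals `m(e)·m(t̄)/m(e')`. -/
theorem coeff_dsub_uniform (x : ℕ) (e : ResExpr) (t : Multiset ResTerm)
    (he : CohQE e e) (e' : ResExpr) (he' : e' ∈ (dsub x e t).support) :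
    ((dsub x e t) e' : ℚ) = (mE e * mMon t : ℚ) / (mE e' : ℚ) := by
  rw [Finsupp.mem_support_iff] at he'
  have hpos : mE e' ≠ 0 := by
    cases e' with
    | inl s => exact (mT_pos s).ne'
    | inr m => exact (mMon_pos m).ne'
  rw [eq_div_iff (by exact_mod_cast hpos)]
  norm_cast
  rcases e with s | m
  · obtain ⟨a, a', ha, ha', h⟩ := he
    replace h : CohT (rout s) (rout s) :=
      h.congr (ha.trans (rmk_rout s).symm) (ha'.trans (rmk_rout s).symm)
    refine dsubRig_mul_mE (P := fun w => ∃ v, qsubst (rout s) x w = some v ∧ .inl v = e')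
      (fun bs => ?_) ?_ ?_ he'
    · rw [← rsubst_map_rmk]
      simp [outE, rsubstE, toQ]
    · rintro w w' ⟨v, hv, rfl⟩ ⟨v', hv', e⟩
      obtain rfl := Sum.inl.inj e
      exact (qsubst_unique h hv hv').2
    · rintro w ⟨v, hv, rfl⟩
      simpa [mE, mT] using card_qsubst h hv
  · obtain ⟨bs, bs', hb, hb', h⟩ := he
    have hm := toMul_rout m
    replace h : CohM (m.toList.map rout) (m.toList.map rout) :=
      h.congr (hb.trans hm.symm) (hb'.trans hm.symm)
    refine dsubRig_mul_mE
      (P := fun w => ∃ v, qsubstL (m.toList.map rout) x w = some v ∧ .inr ↑v = e')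
      (fun bs => ?_) ?_ ?_ he'
    · rw [← rsubstL_map_rmk]
      simp [outE, rsubstE, toQ, toMul]
    · rintro w w' ⟨v, hv, rfl⟩ ⟨v', hv', e⟩
      exact (qsubstL_unique h hv hv' (Multiset.coe_eq_coe.1 (Sum.inr.inj e).symm)).2
    · rintro w ⟨v, hv, rfl⟩
      have h1 := card_qsubstL h hv
      rw [hm] at h1
      simpa [mE] using h1
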